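/- Let s be a string of length ℓ and let k*_w(s) = max over strings z of length p-1 of k_w(sz). For every k ≥ 1 + k*_w(s), the total mass of k-admissible strings having s as a prefix equals b^p · b^{-ℓ}. -/

import Mathlib

open scoped BigOperators

/-- Number of (possibly overlapping) occurrences of the block `w` in `X`. -/
def occCount {α : Type*} [DecidableEq α] (w X : List α) : ℕ :=
  ((List.range X.length).filter fun i => (X.drop i).take w.length = w).length

/-- Number of strings of length `l` over `{0,…,b-1}` with exactly `k` occurrences of `w`
and having `s` as a prefix. -/
def NwPre (b : ℕ) (w s : List (Fin b)) (k l : ℕ) : ℕ :=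
  Fintype.card {f : Fin l → Fin b // occCount w (List.ofFn f) = k ∧ s <+: List.ofFn f}

section Occurrences

variable {α : Type*} [DecidableEq α]

theorem occCount_cons (w : List α) (c : α) (X : List α) :
    occCount w (c :: X) = occCount w X + if w <+: c :: X then 1 else 0 := by
  unfold occCount
  rw [List.length_cons, List.range_succ_eq_map, List.filter_cons, List.filter_map]
  simp only [List.drop_zero, List.prefix_iff_eq_take (l₁ := w), eq_comm (a := w)]
  split_ifs <;> simp_all [Function.comp_def]

theorem occCount_concat {w : List α} (hw : w ≠ []) (s : List α) (a : α) :
    occCount w (s ++ [a]) = occCount w s + if w <:+ s ++ [a] then 1 else 0 := by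
  induction s with
  | nil =>
    rw [List.nil_append, occCount_cons]
    have : w <+: [a] ↔ w <:+ [a] := by
      constructor
      · intro h
        rcases List.prefix_cons_iff.1 h with h | ⟨t, rfl, ht⟩
        · exact absurd h hw
        · simp_all
      · intro h
        rcases List.suffix_cons_iff.1 h with h | h
        · simp_all
        · simp_all
    simp only [this]
  | cons c s ih =>
    rw [List.cons_append, occCount_cons, ih, occCount_cons]
    have hp : w.length ≤ s.length + 1 → (w <+: c :: (s ++ [a]) ↔ w <+: c :: s) := fun h =>
      ⟨fun h1 => List.prefix_of_prefix_length_le h1 (List.prefix_append (c :: s) [a]) (by simpa),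
        fun h1 => h1.trans (List.prefix_append (c :: s) [a])⟩
    have hs : w.length ≤ s.length + 1 → (w <:+ c :: (s ++ [a]) ↔ w <:+ s ++ [a]) := fun h =>
      ⟨fun h1 => List.suffix_of_suffix_length_le h1 (List.suffix_cons _ _) (by simpa),
        fun h1 => h1.trans (List.suffix_cons _ _)⟩
    by_cases h : w.length ≤ s.length + 1
    · simp only [hp h, hs h]; omega
    · have h1 : ¬ w <:+ s ++ [a] := fun h' => h (by simpa using h'.length_le)
      have h2 : ¬ w <+: c :: s := fun h' => h (by simpa using h'.length_le)
      have h3 : w <+: c :: (s ++ [a]) ↔ w <:+ c :: (s ++ [a]) := by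
        constructor
        · intro h'
          have := h'.eq_of_length (by have := h'.length_le; simp at this ⊢; omega)
          rw [this]
        · intro h'
          have := h'.eq_of_length (by have := h'.length_le; simp at this ⊢; omega)
          rw [this]
      simp only [h1, h2, h3, if_false]

theorem occCount_le_append {w : List α} (hw : w ≠ []) (s t : List α) :
    occCount w s ≤ occCount w (s ++ t) := by
  induction t using List.reverseRecOn with
  | nil => simp
  | append_singleton t a ih =>
    rw [← List.append_assoc, occCount_concat hw]; omega

end Occurrences

section Average

variable {α : Type*} [Fintype α]

/-- The average of `f` over all strings of length `n`. -/
noncomputable def stringAvg : ℕ → (List α → ℝ) → ℝ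
  | 0, f => f []
  | n + 1, f => 𝔼 a, stringAvg n fun t => f (a :: t)

theorem stringAvg_succ' (n : ℕ) (f : List α → ℝ) :
    stringAvg (n + 1) f = stringAvg n fun t => 𝔼 a, f (t ++ [a]) := by
  induction n generalizing f with
  | zero => rfl
  | succ n ih =>
    rw [stringAvg, stringAvg]
    simp only [ih, List.cons_append]

theorem stringAvg_congr {n : ℕ} {f g : List α → ℝ} (h : ∀ t, t.length = n → f t = g t) :
    stringAvg n f = stringAvg n g := by
  induction n generalizing f g with
  | zero => exact h [] rfl
  | succ n ih =>
    exact Finset.expect_congr rfl fun a _ => ih fun t ht => h (a :: t) (by simp [ht])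

theorem stringAvg_mono {n : ℕ} {f g : List α → ℝ} (h : ∀ t, f t ≤ g t) :
    stringAvg n f ≤ stringAvg n g := by
  induction n generalizing f g with
  | zero => exact h []
  | succ n ih => exact Finset.expect_le_expect fun a _ => ih fun t => h (a :: t)

theorem stringAvg_sub (n : ℕ) (f g : List α → ℝ) :
    stringAvg n (fun t => f t - g t) = stringAvg n f - stringAvg n g := by
  induction n generalizing f g with
  | zero => rfl
  | succ n ih => simp only [stringAvg, ih, Finset.expect_sub_distrib]

theorem stringAvg_const [Nonempty α] (n : ℕ) (c : ℝ) :
    stringAvg (α := α) n (fun _ => c) = c := by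
  induction n with
  | zero => rfl
  | succ n ih => simp only [stringAvg, ih, Finset.expect_const Finset.univ_nonempty]

theorem expect_ite_eq_mul [DecidableEq α] (c : α) (x : ℝ) :
    (𝔼 a, if a = c then x else 0) = (Fintype.card α : ℝ)⁻¹ * x := by
  rw [Fintype.expect_eq_sum_div_card, Finset.sum_ite_eq']
  simp [div_eq_inv_mul]

theorem stringAvg_ite_prefix_eq [DecidableEq α] [Nonempty α] (s : List α) (n : ℕ) (f : List α → ℝ) :
    stringAvg (s.length + n) (fun t => if s <+: t then f t else 0) =
      ((Fintype.card α : ℝ)⁻¹) ^ s.length * stringAvg n fun t => f (s ++ t) := by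
  induction s generalizing f with
  | nil => simp
  | cons c s ih =>
    rw [List.length_cons, add_right_comm, stringAvg]
    have : ∀ a, (stringAvg (s.length + n) fun t => if c :: s <+: a :: t then f (a :: t) else 0) =
        if a = c then ((Fintype.card α : ℝ)⁻¹) ^ s.length *
          stringAvg n fun t => f (c :: s ++ t) else 0 := by
      intro a
      split_ifs with h
      · subst h
        simpa using ih fun t => f (a :: t)
      · simp [Ne.symm h, List.cons_prefix_cons, stringAvg_const]
    simp only [this]
    rw [expect_ite_eq_mul, pow_succ']
    ring

theorem stringAvg_eq_sum [Nonempty α] (n : ℕ) (f : List α → ℝ) :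
    stringAvg n f = ((Fintype.card α : ℝ)⁻¹) ^ n * ∑ t : Fin n → α, f (List.ofFn t) := by
  induction n generalizing f with
  | zero => simp [stringAvg]
  | succ n ih =>
    rw [stringAvg, Fintype.expect_eq_sum_div_card,
      ← (Fin.consEquiv fun _ : Fin (n + 1) => α).sum_comp, Fintype.sum_prod_type]
    have hcons : ∀ a (t : Fin n → α),
        List.ofFn (Fin.consEquiv (fun _ : Fin (n + 1) => α) (a, t)) = a :: List.ofFn t :=
      fun a t => List.ofFn_cons a t
    simp only [ih, hcons]
    rw [← Finset.mul_sum, pow_succ']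
    field_simp

end Average

section Gain

variable {α : Type*} [DecidableEq α] [Fintype α]

/-- The proportion of strings `t` of length `n` such that `s ++ t` has exactly `k` more
occurrences of `w` than `s`. -/
noncomputable def gainProb (w : List α) (k : ℕ) (s : List α) (n : ℕ) : ℝ :=
  stringAvg n fun t => if occCount w (s ++ t) = occCount w s + k then 1 else 0

theorem gainProb_zero_right (w : List α) (k : ℕ) (s : List α) :
    gainProb w k s 0 = if k = 0 then 1 else 0 := by
  simp [gainProb, stringAvg]

theorem gainProb_cons {w s : List α} (hs : w.length ≤ s.length + 1) (k : ℕ) (c : α) (n : ℕ) :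
    gainProb w k (c :: s) n = gainProb w k s n := by
  unfold gainProb
  congr 1
  ext t
  have : w <+: c :: s ++ t ↔ w <+: c :: s :=
    ⟨fun h => List.prefix_of_prefix_length_le h (List.prefix_append _ _) (by simpa),
      fun h => h.trans (List.prefix_append _ _)⟩
  rw [List.cons_append] at this ⊢
  simp only [occCount_cons, this]
  congr 1
  apply propext
  omega

theorem gainProb_append {w s : List α} (hs : w.length ≤ s.length + 1) (k : ℕ) (r : List α)
    (n : ℕ) : gainProb w k (r ++ s) n = gainProb w k s n := by
  induction r with
  | nil => rfl
  | cons c r ih => rw [List.cons_append, gainProb_cons (by simp; omega), ih]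

theorem gainProb_of_suffix {w s : List α} (h : w <:+ s) (k n : ℕ) :
    gainProb w k s n = gainProb w k w n := by
  obtain ⟨r, rfl⟩ := h
  exact gainProb_append (by omega) k r n

theorem gainProb_succ_succ {w : List α} (hw : w ≠ []) (k : ℕ) (s : List α) (n : ℕ) :
    gainProb w (k + 1) s (n + 1) =
      𝔼 a, if w <:+ s ++ [a] then gainProb w k w n else gainProb w (k + 1) (s ++ [a]) n := by
  rw [gainProb, stringAvg]
  refine Finset.expect_congr rfl fun a _ => ?_
  have hc := occCount_concat hw s a
  split_ifs at hc ⊢ with h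
  · rw [← gainProb_of_suffix h, gainProb]
    simp [hc, add_assoc, add_comm 1 k]
  · simp [gainProb, hc]

theorem sum_gainProb_succ {w : List α} (hw : w ≠ []) (k : ℕ) (s : List α) (n : ℕ) :
    ∑ i ∈ Finset.range (n + 1), gainProb w (k + 1) s i =
      𝔼 a, if w <:+ s ++ [a] then ∑ i ∈ Finset.range n, gainProb w k w i
        else ∑ i ∈ Finset.range n, gainProb w (k + 1) (s ++ [a]) i := by
  rw [Finset.sum_range_succ', gainProb_zero_right, if_neg (by omega), add_zero]
  simp only [gainProb_succ_succ hw]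
  rw [← Finset.expect_sum_comm]
  refine Finset.expect_congr rfl fun a _ => ?_
  split_ifs <;> rfl

variable [Nonempty α]

theorem gainProb_nonneg (w : List α) (k : ℕ) (s : List α) (n : ℕ) : 0 ≤ gainProb w k s n := by
  rw [← stringAvg_const (α := α) n 0]
  exact stringAvg_mono fun t => by positivity

theorem gainProb_le_one (w : List α) (k : ℕ) (s : List α) (n : ℕ) : gainProb w k s n ≤ 1 := by
  rw [← stringAvg_const (α := α) n 1]
  exact stringAvg_mono fun t => by split_ifs <;> norm_num

theorem gainProb_zero_succ {w : List α} (hw : w ≠ []) (s : List α) (n : ℕ) :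
    gainProb w 0 s (n + 1) =
      𝔼 a, if w <:+ s ++ [a] then 0 else gainProb w 0 (s ++ [a]) n := by
  unfold gainProb
  rw [stringAvg]
  refine Finset.expect_congr rfl fun a _ => ?_
  have hc := occCount_concat hw s a
  split_ifs at hc ⊢ with h
  · refine Eq.trans ?_ (stringAvg_const (α := α) n 0)
    congr 1
    ext t
    have := occCount_le_append hw (s ++ [a]) t
    rw [List.append_assoc, List.singleton_append] at this
    rw [if_neg (by omega)]
  · simp [hc]

theorem gainProb_zero_antitone {w : List α} (hw : w ≠ []) (s : List α) :
    Antitone (gainProb w 0 s) := by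
  refine antitone_nat_of_succ_le fun n => ?_
  induction n generalizing s with
  | zero => simpa [gainProb_zero_right] using gainProb_le_one w 0 s 1
  | succ n ih =>
    rw [gainProb_zero_succ hw, gainProb_zero_succ hw s n]
    refine Finset.expect_le_expect fun a _ => ?_
    split_ifs
    · rfl
    · exact ih _

theorem gainProb_zero_add_length_le {w : List α} (hw : w ≠ []) {n : ℕ} {C : ℝ} (hC : 0 ≤ C)
    (h : ∀ s, gainProb w 0 s n ≤ C) (u v : List α) (huv : w = u ++ v) (hv : v ≠ [])
    (s : List α) (hs : u <:+ s) :
    gainProb w 0 s (n + v.length) ≤ C - (Fintype.card α : ℝ)⁻¹ ^ v.length * C := by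
  induction v generalizing u s with
  | nil => exact absurd rfl hv
  | cons a v ih =>
    have hb : (Fintype.card α : ℝ)⁻¹ ≤ 1 := inv_le_one_of_one_le₀ (by
      exact_mod_cast Fintype.card_pos)
    rw [List.length_cons, ← add_assoc, gainProb_zero_succ hw]
    calc _ ≤ 𝔼 x, (C - if x = a then (Fintype.card α : ℝ)⁻¹ ^ v.length * C else 0) := by
          refine Finset.expect_le_expect fun x _ => ?_
          by_cases hx : w <:+ s ++ [x]
          · rw [if_pos hx]
            have : (Fintype.card α : ℝ)⁻¹ ^ v.length * C ≤ C :=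
              mul_le_of_le_one_left hC (pow_le_one₀ (by positivity) hb)
            split_ifs <;> linarith
          · rw [if_neg hx]
            split_ifs with hxa
            · subst hxa
              have hsuf : u ++ [x] <:+ s ++ [x] := by
                obtain ⟨r, rfl⟩ := hs
                exact ⟨r, by simp⟩
              refine ih (u ++ [x]) (by simpa using huv) ?_ _ hsuf
              rintro rfl
              exact hx (huv ▸ hsuf)
            · rw [sub_zero]
              exact (gainProb_zero_antitone hw _ (by omega)).trans (h _)
      _ = _ := by
          rw [Finset.expect_sub_distrib, expect_ite_eq_mul,
            Finset.expect_const Finset.univ_nonempty, pow_succ']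
          ring

theorem exists_gainProb_zero_le {w : List α} (hw : w ≠ []) {ε : ℝ} (hε : 0 < ε) :
    ∃ N, ∀ n ≥ N, ∀ s, gainProb w 0 s n ≤ ε := by
  have hcard : (0 : ℝ) < Fintype.card α := by exact_mod_cast Fintype.card_pos
  set ρ : ℝ := 1 - (Fintype.card α : ℝ)⁻¹ ^ w.length with hρ
  have hρ0 : 0 ≤ ρ := by
    rw [hρ, sub_nonneg]
    exact pow_le_one₀ (by positivity)
      (inv_le_one_of_one_le₀ (by exact_mod_cast Fintype.card_pos))
  have hρ1 : ρ < 1 := by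
    have : 0 < (Fintype.card α : ℝ)⁻¹ ^ w.length := by positivity
    linarith
  have key : ∀ j s, gainProb w 0 s (j * w.length) ≤ ρ ^ j := by
    intro j
    induction j with
    | zero => exact fun s => by simpa using gainProb_le_one w 0 s 0
    | succ j ih =>
      intro s
      rw [Nat.succ_mul]
      refine (gainProb_zero_add_length_le hw (by positivity) ih [] w rfl hw s
        List.nil_suffix).trans_eq ?_
      rw [pow_succ, hρ]
      ring
  obtain ⟨j, hj⟩ := exists_pow_lt_of_lt_one hε hρ1
  exact ⟨j * w.length, fun n hn s => (gainProb_zero_antitone hw s hn).trans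
    ((key j s).trans hj.le)⟩

theorem stringAvg_gainProb_zero_succ {w : List α} (hw : w ≠ []) (n : ℕ) :
    stringAvg (w.length - 1) (fun z => gainProb w 0 z (n + 1)) =
      stringAvg (w.length - 1) (fun z => gainProb w 0 z n) -
        (Fintype.card α : ℝ)⁻¹ ^ w.length * gainProb w 0 w n := by
  have hlen : w.length - 1 + 1 = w.length :=
    Nat.succ_pred_eq_of_pos (List.length_pos_of_ne_nil hw)
  have hpre := stringAvg_ite_prefix_eq w 0 fun x => gainProb w 0 x n
  simp only [add_zero, stringAvg, List.append_nil] at hpre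
  rw [← hpre]
  have hshift : stringAvg (w.length - 1) (fun z => gainProb w 0 z n) =
      stringAvg w.length (fun z => gainProb w 0 z n) := by
    conv_rhs => rw [← hlen, stringAvg]
    have : ∀ a : α, stringAvg (w.length - 1) (fun z => gainProb w 0 (a :: z) n) =
        stringAvg (w.length - 1) (fun z => gainProb w 0 z n) := fun a =>
      stringAvg_congr fun t ht => gainProb_cons (by omega) _ _ _
    simp only [this, Finset.expect_const Finset.univ_nonempty]
  rw [hshift, ← stringAvg_sub]
  simp only [gainProb_zero_succ hw]
  rw [← stringAvg_succ' _ fun x => if w <:+ x then 0 else gainProb w 0 x n, hlen]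
  refine stringAvg_congr fun t ht => ?_
  have : w <:+ t ↔ w <+: t :=
    ⟨fun h => h.eq_of_length ht.symm ▸ List.prefix_rfl,
      fun h => h.eq_of_length ht.symm ▸ List.suffix_rfl⟩
  simp only [this]
  split_ifs <;> simp

theorem sum_gainProb_zero_self {w : List α} (hw : w ≠ []) (n : ℕ) :
    ∑ i ∈ Finset.range n, gainProb w 0 w i =
      (Fintype.card α : ℝ) ^ w.length *
        (1 - stringAvg (w.length - 1) fun z => gainProb w 0 z n) := by
  induction n with
  | zero => simp [gainProb_zero_right, stringAvg_const]
  | succ n ih =>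
    have : (Fintype.card α : ℝ) ^ w.length ≠ 0 := by positivity
    rw [Finset.sum_range_succ, ih, stringAvg_gainProb_zero_succ hw, inv_pow]
    field_simp
    ring

theorem sum_gainProb_zero_self_le {w : List α} (hw : w ≠ []) (n : ℕ) :
    ∑ i ∈ Finset.range n, gainProb w 0 w i ≤ (Fintype.card α : ℝ) ^ w.length := by
  rw [sum_gainProb_zero_self hw]
  refine mul_le_of_le_one_right (by positivity) (sub_le_self _ ?_)
  rw [← stringAvg_const (α := α) (w.length - 1) 0]
  exact stringAvg_mono fun t => gainProb_nonneg _ _ _ _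

theorem sum_gainProb_succ_le {w : List α} (hw : w ≠ []) (k : ℕ) (s : List α) (n : ℕ) :
    ∑ i ∈ Finset.range n, gainProb w (k + 1) s i ≤ (Fintype.card α : ℝ) ^ w.length := by
  induction n generalizing k s with
  | zero => simp
  | succ n ih =>
    rw [sum_gainProb_succ hw]
    refine Finset.expect_le Finset.univ_nonempty fun a _ => ?_
    split_ifs
    · cases k with
      | zero => exact sum_gainProb_zero_self_le hw n
      | succ k => exact ih _ _
    · exact ih _ _

theorem le_sum_gainProb_succ {w : List α} (hw : w ≠ []) {k m : ℕ} {δ : ℝ} (hδ : 0 ≤ δ)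
    (h : ∀ n ≥ m, (Fintype.card α : ℝ) ^ w.length - δ ≤ ∑ i ∈ Finset.range n, gainProb w k w i)
    (s : List α) (n : ℕ) :
    (Fintype.card α : ℝ) ^ w.length - δ - (Fintype.card α : ℝ) ^ w.length * gainProb w 0 s n ≤
      ∑ i ∈ Finset.range (m + n), gainProb w (k + 1) s i := by
  induction n generalizing s with
  | zero =>
    rw [gainProb_zero_right, if_pos rfl]
    have := Finset.sum_nonneg fun i (_ : i ∈ Finset.range (m + 0)) => gainProb_nonneg w (k + 1) s i
    linarith
  | succ n ih =>
    rw [← add_assoc, sum_gainProb_succ hw, gainProb_zero_succ hw, Finset.mul_expect,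
      ← Finset.expect_const (s := (Finset.univ : Finset α)) Finset.univ_nonempty
        ((Fintype.card α : ℝ) ^ w.length - δ), ← Finset.expect_sub_distrib]
    refine Finset.expect_le_expect fun a _ => ?_
    split_ifs
    · simpa using h (m + n) (by omega)
    · exact ih _

theorem exists_le_sum_gainProb_succ {w : List α} (hw : w ≠ []) {k : ℕ}
    (h : ∀ ε > 0, ∃ N, ∀ n ≥ N,
      (Fintype.card α : ℝ) ^ w.length - ε ≤ ∑ i ∈ Finset.range n, gainProb w k w i)
    (s : List α) {ε : ℝ} (hε : 0 < ε) :
    ∃ N, ∀ n ≥ N,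
      (Fintype.card α : ℝ) ^ w.length - ε ≤ ∑ i ∈ Finset.range n, gainProb w (k + 1) s i := by
  have hB : (0 : ℝ) < (Fintype.card α : ℝ) ^ w.length := by positivity
  obtain ⟨m, hm⟩ := h (ε / 2) (by positivity)
  obtain ⟨N, hN⟩ := exists_gainProb_zero_le hw
    (show 0 < ε / 2 / (Fintype.card α : ℝ) ^ w.length by positivity)
  refine ⟨m + N, fun n hn => ?_⟩
  obtain ⟨j, rfl⟩ := Nat.exists_eq_add_of_le (show m ≤ n by omega)
  have h1 := le_sum_gainProb_succ hw (by positivity) hm s j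
  have h2 := (le_div_iff₀' hB).1 (hN j (by omega) s)
  linarith

theorem exists_le_sum_gainProb_self {w : List α} (hw : w ≠ []) (k : ℕ) {ε : ℝ} (hε : 0 < ε) :
    ∃ N, ∀ n ≥ N,
      (Fintype.card α : ℝ) ^ w.length - ε ≤ ∑ i ∈ Finset.range n, gainProb w k w i := by
  induction k generalizing ε with
  | zero =>
    have hB : (0 : ℝ) < (Fintype.card α : ℝ) ^ w.length := by positivity
    obtain ⟨N, hN⟩ := exists_gainProb_zero_le hw
      (show 0 < ε / (Fintype.card α : ℝ) ^ w.length by positivity)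
    refine ⟨N, fun n hn => ?_⟩
    have h1 : stringAvg (w.length - 1) (fun z => gainProb w 0 z n) ≤
        ε / (Fintype.card α : ℝ) ^ w.length := by
      rw [← stringAvg_const (α := α) (w.length - 1) (ε / _)]
      exact stringAvg_mono (hN n hn)
    have h2 := (le_div_iff₀' hB).1 h1
    rw [sum_gainProb_zero_self hw]
    linarith
  | succ k ih => exact exists_le_sum_gainProb_succ hw (fun ε hε => ih hε) w hε

theorem hasSum_gainProb_succ {w : List α} (hw : w ≠ []) (k : ℕ) (s : List α) :
    HasSum (gainProb w (k + 1) s) ((Fintype.card α : ℝ) ^ w.length) := by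
  rw [hasSum_iff_tendsto_nat_of_nonneg (gainProb_nonneg w (k + 1) s), Metric.tendsto_atTop]
  intro ε hε
  obtain ⟨N, hN⟩ := exists_le_sum_gainProb_succ hw
    (fun ε hε => exists_le_sum_gainProb_self hw k hε) s (half_pos hε)
  refine ⟨N, fun n hn => ?_⟩
  have h1 := hN n hn
  have h2 := sum_gainProb_succ_le hw k s n
  rw [Real.dist_eq, abs_lt]
  constructor <;> linarith

end Gain

theorem NwPre_eq_zero {b : ℕ} (w s : List (Fin b)) (k : ℕ) {l : ℕ} (hl : l < s.length) :
    NwPre b w s k l = 0 := by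
  rw [NwPre, Fintype.card_eq_zero_iff]
  refine ⟨fun f => ?_⟩
  have := f.2.2.length_le
  rw [List.length_ofFn] at this
  omega

theorem NwPre_mul_pow {b : ℕ} [NeZero b] (w s : List (Fin b)) (k n : ℕ) :
    (NwPre b w s (occCount w s + k) (n + s.length) : ℝ) * (b : ℝ)⁻¹ ^ (n + s.length) =
      (b : ℝ)⁻¹ ^ s.length * gainProb w k s n := by
  have h := stringAvg_ite_prefix_eq s n
    fun t => if occCount w t = occCount w s + k then (1 : ℝ) else 0
  rw [stringAvg_eq_sum, Fintype.card_fin] at h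
  rw [gainProb, ← h, mul_comm, add_comm n, NwPre, Fintype.card_subtype, Finset.card_filter]
  push_cast
  congr 1
  refine Finset.sum_congr rfl fun f _ => ?_
  by_cases h1 : s <+: List.ofFn f <;>
    by_cases h2 : occCount w (List.ofFn f) = occCount w s + k <;> simp [h1, h2]

/-- If `k ≥ 1 + k*_w(s)` where `k*_w(s) = max_{|z| = p-1} k_w(sz)`, then the total mass of
the `k`-admissible strings having `s` as a prefix equals `b^p · b^{-|s|}`. -/
theorem stmt11 (b : ℕ) (hb : 1 < b) (w : List (Fin b)) (hw : 1 ≤ w.length)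
    (s : List (Fin b)) (k : ℕ)
    (hk : ∀ z : Fin (w.length - 1) → Fin b, occCount w (s ++ List.ofFn z) + 1 ≤ k) :
    ∑' l : ℕ, (NwPre b w s k l : ℝ) * ((b : ℝ)⁻¹) ^ l =
      (b : ℝ) ^ w.length * ((b : ℝ) ^ s.length)⁻¹ := by
  have : NeZero b := ⟨by omega⟩
  have hw' : w ≠ [] := List.ne_nil_of_length_pos hw
  have hks : occCount w s + 1 ≤ k :=
    (Nat.add_le_add_right (occCount_le_append hw' s _) 1).trans (hk fun _ => 0)
  obtain ⟨j, rfl⟩ := Nat.exists_eq_add_of_le hks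
  rw [add_assoc, add_comm 1 j]
  have hsum := (hasSum_gainProb_succ hw' j s).mul_left ((b : ℝ)⁻¹ ^ s.length)
  simp only [← NwPre_mul_pow] at hsum
  rw [hasSum_nat_add_iff (f := fun l =>
    (NwPre b w s (occCount w s + (j + 1)) l : ℝ) * (b : ℝ)⁻¹ ^ l)] at hsum
  rw [hsum.tsum_eq, Finset.sum_eq_zero, Fintype.card_fin, inv_pow, add_zero, mul_comm]
  intro l hl
  rw [NwPre_eq_zero w s _ (Finset.mem_range.1 hl), Nat.cast_zero, zero_mul]
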